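/- If x ∈ E_γ and there exists m ∈ ℕ with |x_m| = γ_m > 0, then x is not a strong mode of the uniform measure μ_γ. -/

import Mathlib

open MeasureTheory Metric Filter Topology

/-- The space `c₀` of real sequences converging to zero, with the supremum norm,
realized as the zero-at-infinity continuous maps on `ℕ`. -/
abbrev CZero : Type := ZeroAtInftyContinuousMap ℕ ℝ

/-- The set `E_γ = {x : ∀ k, |x_k| ≤ γ_k}`. -/
def Egamma (γ : ℕ → ℝ) : Set CZero := {x | ∀ k, |x k| ≤ γ k}

/-- The set `E_γ^δ = {x : ∀ k, |x_k| ≤ max (γ_k - δ) 0}`. -/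
def EgammaD (γ : ℕ → ℝ) (δ : ℝ) : Set CZero := {x | ∀ k, |x k| ≤ max (γ k - δ) 0}

/-- The law `ν_k` of `γ_k ξ_k` where `ξ_k` is uniform on `[-1,1]`: the uniform distribution
on `[-γ_k, γ_k]` if `γ_k > 0`, and the Dirac measure at `0` if `γ_k = 0`. -/
noncomputable def nuMeas (γ : ℕ → ℝ) (k : ℕ) : Measure ℝ :=
  if γ k = 0 then Measure.dirac 0
  else (ENNReal.ofReal (2 * γ k))⁻¹ • volume.restrict (Set.Icc (-(γ k)) (γ k))

/-- `μ` is the law on `c₀` of the random series `ξ = Σ γ_k ξ_k e_k` with `ξ_k` i.i.d. uniform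
on `[-1,1]` (equivalently, the pushforward under `t ↦ (γ_k t_k)_k` of the countable product of
uniform measures on `[-1,1]`), characterized by its finite-dimensional marginals: the
coordinates are independent with `x_k ∼ ν_k`. -/
def IsUniformSeriesLaw (γ : ℕ → ℝ) {m : MeasurableSpace CZero} (μ : Measure CZero) : Prop :=
  ∀ (n : ℕ) (A : ℕ → Set ℝ), (∀ k, MeasurableSet (A k)) →
    μ {x : CZero | ∀ k < n, x k ∈ A k} = ∏ k ∈ Finset.range n, nuMeas γ k (A k)

/-- The maximal probability of an open ball of radius `δ` under `μ`. -/
noncomputable def maxBallProb {X : Type*} [PseudoMetricSpace X] [MeasurableSpace X]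
    (μ : Measure X) (δ : ℝ) : ℝ :=
  ⨆ x : X, (μ (ball x δ)).toReal

/-- `xhat` is a strong mode of `μ` if `μ(B^δ(xhat))/M^δ → 1` as `δ → 0⁺`. -/
def IsStrongMode {X : Type*} [PseudoMetricSpace X] [MeasurableSpace X]
    (μ : Measure X) (xhat : X) : Prop :=
  Tendsto (fun δ : ℝ => (μ (ball xhat δ)).toReal / maxBallProb μ δ) (𝓝[>] (0 : ℝ)) (𝓝 1)

/-- `xhat` is a generalized mode of `μ` if for every positive sequence `δ_n → 0` there is an
approximating sequence `w_n → xhat` with `μ(B^{δ_n}(w_n))/M^{δ_n} → 1`. -/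
def IsGeneralizedMode {X : Type*} [PseudoMetricSpace X] [MeasurableSpace X]
    (μ : Measure X) (xhat : X) : Prop :=
  ∀ δ : ℕ → ℝ, (∀ n, 0 < δ n) → Tendsto δ atTop (𝓝 (0 : ℝ)) →
    ∃ w : ℕ → X, Tendsto w atTop (𝓝 xhat) ∧
      Tendsto (fun n => (μ (ball (w n) (δ n))).toReal / maxBallProb μ (δ n)) atTop (𝓝 1)

/-- The sequence `x` with its `m`-th coordinate replaced by `0`. -/
def CZero.zeroCoord (x : CZero) (m : ℕ) : CZero where
  toFun := Function.update x m 0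
  continuous_toFun := continuous_of_discreteTopology
  zero_at_infty' := by
    refine x.zero_at_infty'.congr' ?_
    have h : {m}ᶜ ∈ cocompact ℕ := isCompact_singleton.compl_mem_cocompact
    filter_upwards [h] with k hk
    exact (Function.update_of_ne hk _ _).symm

theorem CZero.coe_zeroCoord (x : CZero) (m : ℕ) : ⇑(x.zeroCoord m) = Function.update x m 0 :=
  rfl

theorem CZero.zeroCoord_self (x : CZero) (m : ℕ) : x.zeroCoord m m = 0 := by
  simp [CZero.coe_zeroCoord]

theorem CZero.zeroCoord_of_ne (x : CZero) {m k : ℕ} (h : k ≠ m) : x.zeroCoord m k = x k := by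
  simp [CZero.coe_zeroCoord, h]

theorem CZero.dist_coord_le (x y : CZero) (k : ℕ) : dist (x k) (y k) ≤ dist x y :=
  BoundedContinuousFunction.dist_coe_le_dist (f := x.toBCF) (g := y.toBCF) k

theorem CZero.continuous_coord (k : ℕ) : Continuous fun x : CZero => x k :=
  (LipschitzWith.of_dist_le_mul (K := 1) fun x y => by
    simpa using CZero.dist_coord_le x y k).continuous

theorem CZero.mem_ball_iff (x y : CZero) {δ : ℝ} (hδ : 0 < δ) :
    y ∈ ball x δ ↔ ∀ k, y k ∈ ball (x k) δ := by
  refine ⟨fun h k => (CZero.dist_coord_le y x k).trans_lt h, fun h => ?_⟩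
  have hlim : Tendsto (fun k => dist (y k) (x k)) (cocompact ℕ) (𝓝 0) := by
    simpa using y.zero_at_infty'.dist x.zero_at_infty'
  rw [cocompact_eq_cofinite, Nat.cofinite_eq_atTop] at hlim
  obtain ⟨N, hN⟩ := eventually_atTop.1 (hlim.eventually_lt_const (half_pos hδ))
  have hfin : ∀ᶠ C in 𝓝[<] δ, ∀ k ∈ Finset.range N, dist (y k) (x k) < C :=
    (Finset.eventually_all _).2 fun k _ =>
      (lt_mem_nhds (h k)).filter_mono nhdsWithin_le_nhds
  have hhalf : ∀ᶠ C in 𝓝[<] δ, δ / 2 < C :=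
    (lt_mem_nhds (half_lt_self hδ)).filter_mono nhdsWithin_le_nhds
  obtain ⟨C, hC, hC2, hCδ⟩ := (hfin.and (hhalf.and self_mem_nhdsWithin)).exists
  have hle : dist y x ≤ C := by
    refine (BoundedContinuousFunction.dist_le (f := y.toBCF) (g := x.toBCF)
      ((half_pos hδ).trans hC2).le).2 fun k => ?_
    rcases lt_or_ge k N with hk | hk
    · exact (hC k (Finset.mem_range.2 hk)).le
    · exact ((hN k hk).trans hC2).le
  exact hle.trans_lt hCδ

/-- The probability of an open ball is the infimum of the probabilities of the cylinders
obtained by restricting finitely many coordinates. -/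
theorem IsUniformSeriesLaw.measure_ball {γ : ℕ → ℝ} [MeasurableSpace CZero] [BorelSpace CZero]
    {μ : Measure CZero} [IsProbabilityMeasure μ] (hμ : IsUniformSeriesLaw γ μ)
    (x : CZero) {δ : ℝ} (hδ : 0 < δ) :
    μ (ball x δ) = ⨅ n, ∏ k ∈ Finset.range n, nuMeas γ k (ball (x k) δ) := by
  have hball : ball x δ = ⋂ n, {y : CZero | ∀ k < n, y k ∈ ball (x k) δ} := by
    ext y
    simp only [CZero.mem_ball_iff x y hδ, Set.mem_iInter, Set.mem_ofPred_eq]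
    exact ⟨fun h _ k _ => h k, fun h k => h (k + 1) k k.lt_succ_self⟩
  have hmeas (n : ℕ) : MeasurableSet {y : CZero | ∀ k < n, y k ∈ ball (x k) δ} := by
    simp only [Set.ofPred_forall]
    exact MeasurableSet.iInter fun k => MeasurableSet.iInter fun _ =>
      (isOpen_ball.preimage (CZero.continuous_coord k)).measurableSet
  have hanti : Antitone fun n : ℕ => {y : CZero | ∀ k < n, y k ∈ ball (x k) δ} :=
    fun a b hab y hy k hk => hy k (hk.trans_le hab)
  rw [hball, hanti.measure_iInter (fun n => (hmeas n).nullMeasurableSet)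
    ⟨0, measure_ne_top _ _⟩]
  exact iInf_congr fun n => hμ n _ fun k => measurableSet_ball

/-- An interval centred at an endpoint of the support of `ν_k` has at most half the mass of the
interval of the same length centred at the origin. -/
theorem two_mul_nuMeas_ball_le {γ : ℕ → ℝ} {m : ℕ} {a δ : ℝ} (ha : |a| = γ m)
    (hγm : 0 < γ m) (hδγ : δ ≤ γ m) :
    2 * nuMeas γ m (ball a δ) ≤ nuMeas γ m (ball 0 δ) := by
  have hendpoint : volume (ball a δ ∩ Set.Icc (-γ m) (γ m)) ≤ ENNReal.ofReal δ := by
    rcases abs_choice a with h | h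
    · calc volume (ball a δ ∩ Set.Icc (-γ m) (γ m)) ≤ volume (Set.Icc (γ m - δ) (γ m)) := by
            refine measure_mono fun y hy => ⟨?_, hy.2.2⟩
            have := (abs_lt.1 (Real.dist_eq y a ▸ mem_ball.1 hy.1)).1
            linarith
        _ = ENNReal.ofReal δ := by simp
    · calc volume (ball a δ ∩ Set.Icc (-γ m) (γ m)) ≤ volume (Set.Icc (-γ m) (-γ m + δ)) := by
            refine measure_mono fun y hy => ⟨hy.2.1, ?_⟩
            have := (abs_lt.1 (Real.dist_eq y a ▸ mem_ball.1 hy.1)).2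
            linarith
        _ = ENNReal.ofReal δ := by simp
  have hcentre : ball (0 : ℝ) δ ∩ Set.Icc (-γ m) (γ m) = ball 0 δ := by
    refine Set.inter_eq_left.2 fun y hy => ?_
    have := abs_lt.1 (mem_ball_zero_iff.1 hy)
    exact ⟨by linarith, by linarith⟩
  simp only [nuMeas, hγm.ne', if_false, Measure.smul_apply, smul_eq_mul,
    Measure.restrict_apply measurableSet_ball, hcentre, Real.volume_ball]
  rw [mul_left_comm, ENNReal.ofReal_mul (q := δ) zero_le_two, ENNReal.ofReal_ofNat]
  gcongr

theorem IsUniformSeriesLaw.two_mul_measure_ball_le {γ : ℕ → ℝ} [MeasurableSpace CZero]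
    [BorelSpace CZero] {μ : Measure CZero} [IsProbabilityMeasure μ]
    (hμ : IsUniformSeriesLaw γ μ) {x : CZero} {m : ℕ} (hm : |x m| = γ m) (hγm : 0 < γ m)
    {δ : ℝ} (hδ : 0 < δ) (hδγ : δ ≤ γ m) :
    2 * μ (ball x δ) ≤ μ (ball (x.zeroCoord m) δ) := by
  have key {n : ℕ} (hn : m < n) :
      2 * ∏ k ∈ Finset.range n, nuMeas γ k (ball (x k) δ) ≤
        ∏ k ∈ Finset.range n, nuMeas γ k (ball (x.zeroCoord m k) δ) := by
    rw [← Finset.mul_prod_erase _ _ (Finset.mem_range.2 hn),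
      ← Finset.mul_prod_erase _ _ (Finset.mem_range.2 hn), ← mul_assoc, CZero.zeroCoord_self,
      Finset.prod_congr rfl fun k hk => by
        rw [← CZero.zeroCoord_of_ne x (Finset.ne_of_mem_erase hk)]]
    gcongr
    exact two_mul_nuMeas_ball_le hm hγm hδγ
  have hcyl (n : ℕ) : μ {y : CZero | ∀ k < n, y k ∈ ball (x.zeroCoord m k) δ} =
      ∏ k ∈ Finset.range n, nuMeas γ k (ball (x.zeroCoord m k) δ) :=
    hμ n _ fun k => measurableSet_ball
  rw [hμ.measure_ball _ hδ, hμ.measure_ball _ hδ]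
  refine le_iInf fun n => ?_
  calc 2 * ⨅ n, ∏ k ∈ Finset.range n, nuMeas γ k (ball (x k) δ)
      ≤ 2 * ∏ k ∈ Finset.range (max n (m + 1)), nuMeas γ k (ball (x k) δ) := by
        gcongr
        exact iInf_le _ _
    _ ≤ ∏ k ∈ Finset.range (max n (m + 1)), nuMeas γ k (ball (x.zeroCoord m k) δ) :=
        key (lt_max_of_lt_right m.lt_succ_self)
    _ ≤ ∏ k ∈ Finset.range n, nuMeas γ k (ball (x.zeroCoord m k) δ) := by
        rw [← hcyl, ← hcyl]
        exact measure_mono fun y hy k hk => hy k (lt_max_of_lt_left hk)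

theorem measure_ball_le_maxBallProb {X : Type*} [PseudoMetricSpace X] [MeasurableSpace X]
    (μ : Measure X) [IsFiniteMeasure μ] (x : X) (δ : ℝ) :
    (μ (ball x δ)).toReal ≤ maxBallProb μ δ :=
  le_ciSup (f := fun x => (μ (ball x δ)).toReal)
    ⟨(μ Set.univ).toReal, by
      rintro _ ⟨y, rfl⟩
      exact ENNReal.toReal_mono (measure_ne_top _ _) (measure_mono (Set.subset_univ _))⟩ x

theorem not_strongMode_of_touching_bound (γ : ℕ → ℝ) (hγ0 : ∀ k, 0 ≤ γ k)
    (hγ : Tendsto γ atTop (𝓝 (0 : ℝ)))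
    [MeasurableSpace CZero] [BorelSpace CZero]
    (μ : Measure CZero) [IsProbabilityMeasure μ] (hμ : IsUniformSeriesLaw γ μ)
    (x : CZero) (hx : x ∈ Egamma γ) (m : ℕ) (hm : |x m| = γ m) (hγm : 0 < γ m) :
    ¬ IsStrongMode μ x := by
  intro h
  have hhalf : ∀ᶠ δ in 𝓝[>] (0 : ℝ), (μ (ball x δ)).toReal / maxBallProb μ δ ≤ 1 / 2 := by
    filter_upwards [Ioc_mem_nhdsGT hγm] with δ hδ
    have hle := ENNReal.toReal_mono (measure_ne_top _ _)
      (hμ.two_mul_measure_ball_le hm hγm hδ.1 hδ.2)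
    rw [ENNReal.toReal_mul, ENNReal.toReal_ofNat] at hle
    have hmax := measure_ball_le_maxBallProb μ (x.zeroCoord m) δ
    refine div_le_of_le_mul₀ (ENNReal.toReal_nonneg.trans hmax) (by norm_num) ?_
    linarith
  have := le_of_tendsto h hhalf
  norm_num at this
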